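/- arXiv:1610.09162 — 2 statements merged into one kernel-verified Lean document; each statement's English description precedes it below -/
import Mathlib

section
/- Assume that L/K is an extension of analytic fields, 0 < α < 1, and S ⊆ L is a subset admitting an α-perturbation φ : S → L with image S' = φ(S). Then φ extends uniquely to an isometric K-isomorphism of analytic fields φ : hat{K(S)} ≅ hat{K(S')}, and this extension is an α-perturbation of the identity of hat{K(S)} (i.e. the embedding hat{K(S)} → L obtained by composing with the inclusion hat{K(S')} ⊆ L is an α-perturbation of the inclusion hat{K(S)} ⊆ L). -/
open Metric

set_option linter.unusedSectionVars false

/-!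
Ambient setting: every extension of analytic (complete, non-archimedean, real-valued)
fields `L/K` embeds isometrically into an algebraically closed, complete,
non-archimedean normed field `Ω` (e.g. the completed algebraic closure of `L`).
We therefore formalize analytic fields as closed subfields of such an ambient field `Ω`.
-/

variable {Ω : Type*} [NormedField Ω] [CompleteSpace Ω] [IsUltrametricDist Ω] [IsAlgClosed Ω]

/-- The completion `hat{K(S)}` of the subfield generated by `K` and `S`, realized inside
the ambient analytic field `Ω` as the topological closure of the generated subfield. -/
noncomputable def hatGen (K : Subfield Ω) (S : Set Ω) : Subfield Ω :=
  (Subfield.closure ((K : Set Ω) ∪ S)).topologicalClosure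

/-- `t` is topologically algebraic ("topgebraic") over `K`: it lies in the closure of the
set of elements algebraic over `K`, i.e. in the completed algebraic closure `hat{K^a}`. -/
def IsTopgebraicElem (K : Subfield Ω) (t : Ω) : Prop :=
  t ∈ closure {x : Ω | IsAlgebraic K x}

/-- `t` is topologically transcendental over `K`. -/
def TopTranscendental (K : Subfield Ω) (t : Ω) : Prop := ¬ IsTopgebraicElem K t

/-- `S` is topgebraically independent over `K`: every `x ∈ S` is topologically
transcendental over `hat{K(S \ {x})}`. -/
def TopgebraicIndep (K : Subfield Ω) (S : Set Ω) : Prop :=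
  ∀ x ∈ S, TopTranscendental (hatGen K (S \ {x})) x

/-- `S` topgebraically generates `L` over `K`: the extension `L / hat{K(S)}` is
topgebraic, i.e. `L` is contained in the completed algebraic closure of `hat{K(S)}`. -/
def TopgebraicallyGenerates (K L : Subfield Ω) (S : Set Ω) : Prop :=
  (L : Set Ω) ⊆ closure {x : Ω | IsAlgebraic (hatGen K S) x}

/-- The topological transcendence degree of `L/K`: the least cardinal bounding the
cardinality of every topgebraically independent subset of `L`. -/
noncomputable def topdeg (K L : Subfield Ω) : Cardinal :=
  ⨆ S : {S : Set Ω // S ⊆ (L : Set Ω) ∧ TopgebraicIndep K S}, Cardinal.mk S.1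

/-- The topgebraic generating degree of `L/K`: the least cardinality of a
topgebraically generating subset of `L` over `K`. -/
noncomputable def Topdeg (K L : Subfield Ω) : Cardinal :=
  ⨅ S : {S : Set Ω // S ⊆ (L : Set Ω) ∧ TopgebraicallyGenerates K L S}, Cardinal.mk S.1

/-- The `K`-radius of `t`: the distance from `t` to the algebraic closure of `K`. -/
noncomputable def rad (K : Subfield Ω) (t : Ω) : ℝ :=
  Metric.infDist t {x : Ω | IsAlgebraic K x}

/-- The `K`-multiradius of an element `t` of `S`. -/
noncomputable def radS (K : Subfield Ω) (S : Set Ω) (t : Ω) : ℝ :=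
  rad (hatGen K (S \ {t})) t

lemma mem_hatGen_of_mem {K : Subfield Ω} {S : Set Ω} {c : Ω} (hc : c ∈ K) : c ∈ hatGen K S :=
  Subfield.le_topologicalClosure _ (Subfield.subset_closure (Or.inl hc))

lemma mem_hatGen_of_mem_set {K : Subfield Ω} {S : Set Ω} {t : Ω} (ht : t ∈ S) : t ∈ hatGen K S :=
  Subfield.le_topologicalClosure _ (Subfield.subset_closure (Or.inr ht))

open Polynomial in
/-- Multiplying by a linear factor `X + C b` with `r ≤ ‖b‖` preserves the property that the
Gauss norm of radius `r` is attained at the constant coefficient. -/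
lemma norm_coeff_mul_pow_le_of_X_add_C_mul {F : Type*} [NormedField F] [IsUltrametricDist F]
    {f : F[X]} {r : ℝ} (hr : 0 ≤ r) (hf : ∀ j, ‖f.coeff j‖ * r ^ j ≤ ‖f.coeff 0‖)
    {b : F} (hb : r ≤ ‖b‖) (j : ℕ) :
    ‖((X + C b) * f).coeff j‖ * r ^ j ≤ ‖((X + C b) * f).coeff 0‖ := by
  cases j with
  | zero => simp
  | succ j =>
    have h0 : ((X + C b) * f).coeff 0 = b * f.coeff 0 := by simp [mul_coeff_zero]
    have h1 : ((X + C b) * f).coeff (j + 1) = f.coeff j + b * f.coeff (j + 1) := by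
      rw [add_mul, coeff_add, coeff_X_mul, coeff_C_mul]
    rw [h0, h1, norm_mul]
    have hrj : 0 ≤ r ^ (j + 1) := by positivity
    refine (mul_le_mul_of_nonneg_right (IsUltrametricDist.norm_add_le_max _ _) hrj).trans ?_
    rw [max_mul_of_nonneg _ _ hrj]
    refine max_le ?_ ?_
    · calc ‖f.coeff j‖ * r ^ (j + 1) = r * (‖f.coeff j‖ * r ^ j) := by ring
        _ ≤ ‖b‖ * ‖f.coeff 0‖ := by gcongr; exact hf j
    · calc ‖b * f.coeff (j + 1)‖ * r ^ (j + 1)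
          = ‖b‖ * (‖f.coeff (j + 1)‖ * r ^ (j + 1)) := by rw [norm_mul]; ring
        _ ≤ ‖b‖ * ‖f.coeff 0‖ := by gcongr; exact hf _

lemma rad_nonneg (k : Subfield Ω) (t : Ω) : 0 ≤ rad k t := Metric.infDist_nonneg

open Polynomial in
lemma norm_hasseDeriv_eval_mul_rad_pow_le (k : Subfield Ω) (t : Ω) {p : Polynomial Ω}
    (hp : p ∈ lifts (algebraMap k Ω)) (j : ℕ) :
    ‖(hasseDeriv j p).eval t‖ * rad k t ^ j ≤ ‖p.eval t‖ := by
  have hroots : ∀ a ∈ p.roots, rad k t ≤ ‖t - a‖ := by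
    intro a ha
    obtain ⟨q, rfl⟩ := (mem_lifts p).1 hp
    rw [← dist_eq_norm]
    refine Metric.infDist_le_dist_of_mem (show IsAlgebraic k a from ⟨q, ?_, ?_⟩)
    · rintro rfl
      simp at ha
    · simpa [aeval_def, eval_map] using (mem_roots'.1 ha).2
  have key : ∀ s : Multiset Ω, (∀ a ∈ s, rad k t ≤ ‖t - a‖) → ∀ i,
      ‖(taylor t (s.map fun a => X - C a).prod).coeff i‖ * rad k t ^ i ≤
        ‖(taylor t (s.map fun a => X - C a).prod).coeff 0‖ := by
    intro s
    induction s using Multiset.induction with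
    | empty =>
      intro _ i
      cases i <;> simp [coeff_one]
    | cons a s ih =>
      intro h i
      have : taylor t (X - C a) = X + C (t - a) := by simp; ring
      rw [Multiset.map_cons, Multiset.prod_cons, taylor_mul, this]
      exact norm_coeff_mul_pow_le_of_X_add_C_mul (rad_nonneg k t)
        (ih fun b hb => h b (Multiset.mem_cons_of_mem hb)) (h a (Multiset.mem_cons_self a s)) i
  have h := key p.roots hroots j
  have e : p = C p.leadingCoeff * (p.roots.map fun a => X - C a).prod :=
    (IsAlgClosed.splits p).eq_prod_roots
  rw [← taylor_coeff, ← taylor_coeff_zero, e, taylor_mul, taylor_C, coeff_C_mul, coeff_C_mul,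
    norm_mul, norm_mul, mul_assoc]
  gcongr

/-- `b` is an `α`-perturbation of `a`; the first alternative accounts for `a = b = 0`. -/
def IsNear (α : ℝ) (a b : Ω) : Prop := a = b ∨ ‖a - b‖ < α * ‖a‖

namespace IsNear

variable {α : ℝ} {a b c d : Ω}

lemma norm_sub_lt (h : IsNear α a b) (h0 : 0 < α) (ha : a ≠ 0) : ‖a - b‖ < α * ‖a‖ := by
  rcases h with rfl | h
  · simpa [h0] using ha
  · exact h

lemma norm_eq (h : IsNear α a b) (h1 : α < 1) : ‖b‖ = ‖a‖ := by
  rcases h with rfl | h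
  · rfl
  · have hlt : ‖a - b‖ < ‖a‖ := h.trans_le (mul_le_of_le_one_left (norm_nonneg a) h1.le)
    by_contra hne
    have hmax := IsUltrametricDist.norm_add_eq_max_of_norm_ne_norm (x := a) (y := -b)
      (by rw [norm_neg]; exact Ne.symm hne)
    rw [← sub_eq_add_neg, norm_neg] at hmax
    exact absurd (le_max_left ‖a‖ ‖b‖) (by rw [← hmax]; exact hlt.not_ge)

lemma div (hab : IsNear α a b) (hcd : IsNear α c d) (h0 : 0 < α) (h1 : α < 1) :
    IsNear α (a / c) (b / d) := by
  have hba := hab.norm_eq h1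
  have hdc := hcd.norm_eq h1
  by_cases ha : a = 0
  · have hb : b = 0 := by simpa [ha] using hba
    left; simp [ha, hb]
  by_cases hc : c = 0
  · have hd : d = 0 := by simpa [hc] using hdc
    left; simp [hc, hd]
  have hd : d ≠ 0 := by
    rintro rfl
    exact hc (norm_eq_zero.1 (by simpa using hdc.symm))
  have hpos : 0 < ‖a‖ := norm_pos_iff.2 ha
  have hpos' : 0 < ‖c‖ := norm_pos_iff.2 hc
  right
  have e : a / c - b / d = (a - b) / d + a * (d - c) / (c * d) := by field_simp; ring
  rw [e]
  refine (IsUltrametricDist.norm_add_le_max _ _).trans_lt (max_lt ?_ ?_)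
  · rw [norm_div, norm_div, hdc, ← mul_div_assoc]
    exact div_lt_div_of_pos_right (hab.norm_sub_lt h0 ha) hpos'
  · rw [norm_div, norm_div, norm_mul, norm_mul, hdc, norm_sub_rev, ← mul_div_assoc,
      div_lt_div_iff₀ (by positivity) hpos']
    have := mul_lt_mul_of_pos_left (hcd.norm_sub_lt h0 hc) (mul_pos hpos hpos')
    linarith

end IsNear

section MultivariateTaylor

variable {σ : Type*} [Fintype σ] {K : Subfield Ω}

/-- The value at `t` of the Hasse derivative of multi-order `I` of `P`. -/
noncomputable def mvHasse (P : MvPolynomial σ K) (t : σ → Ω) (I : σ → ℕ) : Ω :=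
  ∑ m ∈ P.support, ((P.coeff m : K) : Ω) * ∏ i, ((m i).choose (I i) : Ω) * t i ^ (m i - I i)

lemma mvHasse_zero (P : MvPolynomial σ K) (t : σ → Ω) :
    mvHasse P t 0 = MvPolynomial.aeval t P := by
  rw [MvPolynomial.aeval_def, MvPolynomial.eval₂_eq']
  simp only [mvHasse, Pi.zero_apply, Nat.choose_zero_right, Nat.cast_one, one_mul, Nat.sub_zero]
  rfl

lemma exists_aeval_eq_sum_mvHasse (P : MvPolynomial σ K) (t t' : σ → Ω) :
    ∃ B : Finset (σ → ℕ), 0 ∈ B ∧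
      MvPolynomial.aeval t' P = ∑ I ∈ B, mvHasse P t I * ∏ i, (t' i - t i) ^ I i := by
  classical
  set N := P.totalDegree
  refine ⟨Fintype.piFinset fun _ => Finset.range (N + 1), by simp, ?_⟩
  have hbin : ∀ m ∈ P.support, ∏ i, t' i ^ m i =
      ∑ I ∈ Fintype.piFinset fun _ : σ => Finset.range (N + 1),
        ∏ i, (t' i - t i) ^ I i * t i ^ (m i - I i) * ((m i).choose (I i) : Ω) := by
    intro m hm
    rw [← Finset.prod_univ_sum (fun _ => Finset.range (N + 1))
      fun i j => (t' i - t i) ^ j * t i ^ (m i - j) * ((m i).choose j : Ω)]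
    refine Finset.prod_congr rfl fun i _ => ?_
    have hi : m i ≤ N := (Finsupp.le_degree i m).trans (MvPolynomial.le_totalDegree hm)
    conv_lhs => rw [← sub_add_cancel (t' i) (t i), add_pow]
    refine Finset.sum_subset (Finset.range_mono (by omega)) fun j _ hj => ?_
    rw [Nat.choose_eq_zero_of_lt (by simpa using hj)]
    simp
  rw [MvPolynomial.aeval_def, MvPolynomial.eval₂_eq']
  simp only [mvHasse, Finset.sum_mul]
  rw [Finset.sum_comm]
  refine Finset.sum_congr rfl fun m hm => ?_
  rw [hbin m hm, Finset.mul_sum]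
  refine Finset.sum_congr rfl fun I _ => ?_
  rw [mul_assoc, ← Finset.prod_mul_distrib]
  exact congrArg _ (Finset.prod_congr rfl fun i _ => by ring)

open Polynomial in
lemma norm_mvHasse_mul_rad_pow_le [DecidableEq σ] (P : MvPolynomial σ K) (t : σ → Ω)
    (I : σ → ℕ) (i : σ) (k : Subfield Ω) (hK : K ≤ k) (ht : ∀ l, l ≠ i → t l ∈ k) :
    ‖mvHasse P t I‖ * rad k (t i) ^ I i ≤ ‖mvHasse P t (Function.update I i 0)‖ := by
  set c : (σ →₀ ℕ) → Ω := fun m => ((P.coeff m : K) : Ω) *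
    ∏ l ∈ Finset.univ.erase i, ((m l).choose (I l) : Ω) * t l ^ (m l - I l) with hc
  set p : Polynomial Ω := ∑ m ∈ P.support, monomial (m i) (c m) with hp
  have hck : ∀ m, c m ∈ k := fun m => mul_mem (hK (P.coeff m).2)
    (prod_mem fun l hl => mul_mem (natCast_mem k _) (pow_mem (ht l (Finset.ne_of_mem_erase hl)) _))
  have hlift : p ∈ lifts (algebraMap k Ω) :=
    sum_mem fun m _ => monomial_mem_lifts _ ⟨⟨c m, hck m⟩, rfl⟩
  have heval : ∀ j, (hasseDeriv j p).eval (t i) = mvHasse P t (Function.update I i j) := by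
    intro j
    rw [hp, map_sum, eval_finsetSum]
    refine Finset.sum_congr rfl fun m _ => ?_
    rw [hasseDeriv_monomial, eval_monomial, ← Finset.mul_prod_erase _ _ (Finset.mem_univ i)]
    have : ∏ l ∈ Finset.univ.erase i, ((m l).choose (Function.update I i j l) : Ω) *
        t l ^ (m l - Function.update I i j l) =
        ∏ l ∈ Finset.univ.erase i, ((m l).choose (I l) : Ω) * t l ^ (m l - I l) :=
      Finset.prod_congr rfl fun l hl => by
        rw [Function.update_of_ne (Finset.ne_of_mem_erase hl)]
    rw [this, hc, Function.update_self]
    ring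
  have h := norm_hasseDeriv_eval_mul_rad_pow_le k (t i) hlift (I i)
  rwa [heval, Function.update_eq_self, ← hasseDeriv_zero' p, heval] at h

lemma norm_mvHasse_mul_prod_le (P : MvPolynomial σ K) (t : σ → Ω) (k : σ → Subfield Ω)
    (hK : ∀ i, K ≤ k i) (ht : ∀ i l, l ≠ i → t l ∈ k i) (I : σ → ℕ) :
    ‖mvHasse P t I‖ * ∏ i, rad (k i) (t i) ^ I i ≤ ‖MvPolynomial.aeval t P‖ := by
  classical
  have key : ∀ A : Finset σ, ‖mvHasse P t I‖ * ∏ i ∈ A, rad (k i) (t i) ^ I i ≤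
      ‖mvHasse P t (fun i => if i ∈ A then 0 else I i)‖ := by
    intro A
    induction A using Finset.induction_on with
    | empty => simp
    | insert a A ha ih =>
      have h := norm_mvHasse_mul_rad_pow_le P t (fun i => if i ∈ A then 0 else I i) a (k a)
        (hK a) (ht a)
      have e : Function.update (fun i => if i ∈ A then 0 else I i) a 0 =
          fun i => if i ∈ insert a A then 0 else I i := by
        funext i
        by_cases hi : i = a
        · subst hi; simp
        · simp [hi]
      rw [e] at h
      refine le_trans ?_ h
      rw [Finset.prod_insert ha, mul_comm (_ ^ _), ← mul_assoc]
      simp only [ha, if_false]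
      exact mul_le_mul_of_nonneg_right ih (pow_nonneg (rad_nonneg _ _) _)
  have h := key Finset.univ
  simp only [Finset.mem_univ, if_true] at h
  rwa [← mvHasse_zero]

lemma isNear_aeval {α : ℝ} (hα0 : 0 < α) (hα1 : α < 1) (P : MvPolynomial σ K) (t t' : σ → Ω)
    (k : σ → Subfield Ω) (hK : ∀ i, K ≤ k i) (ht : ∀ i l, l ≠ i → t l ∈ k i)
    (h : ∀ i, dist (t i) (t' i) < α * rad (k i) (t i)) :
    IsNear α (MvPolynomial.aeval t P) (MvPolynomial.aeval t' P) := by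
  classical
  obtain ⟨B, hB, e⟩ := exists_aeval_eq_sum_mvHasse P t t'
  rw [← Finset.add_sum_erase _ _ hB, mvHasse_zero] at e
  simp only [Pi.zero_apply, pow_zero, Finset.prod_const_one, mul_one] at e
  have hr : ∀ i, 0 < rad (k i) (t i) := fun i =>
    pos_of_mul_pos_right (dist_nonneg.trans_lt (h i)) hα0.le
  have hρ : ∀ i, ‖t' i - t i‖ / rad (k i) (t i) < α := fun i => by
    rw [div_lt_iff₀ (hr i), ← dist_eq_norm, dist_comm]
    exact h i
  have hρ0 : ∀ i, 0 ≤ ‖t' i - t i‖ / rad (k i) (t i) := fun i =>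
    div_nonneg (norm_nonneg _) (hr i).le
  have hprod : ∀ I ∈ B.erase 0, ∏ i, (‖t' i - t i‖ / rad (k i) (t i)) ^ I i < α := by
    intro I hI
    obtain ⟨i, hi⟩ := Function.ne_iff.1 (Finset.ne_of_mem_erase hI)
    rw [← Finset.mul_prod_erase _ _ (Finset.mem_univ i)]
    calc _ ≤ (‖t' i - t i‖ / rad (k i) (t i)) ^ I i * 1 := by
          gcongr
          · exact pow_nonneg (hρ0 i) _
          · exact Finset.prod_le_one (fun l _ => pow_nonneg (hρ0 l) _)
              fun l _ => pow_le_one₀ (hρ0 l) ((hρ l).trans hα1).le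
      _ ≤ ‖t' i - t i‖ / rad (k i) (t i) := by
          rw [mul_one]
          exact pow_le_of_le_one (hρ0 i) ((hρ i).trans hα1).le hi
      _ < α := hρ i
  have hterm : ∀ I, ‖mvHasse P t I * ∏ i, (t' i - t i) ^ I i‖ ≤
      ‖MvPolynomial.aeval t P‖ * ∏ i, (‖t' i - t i‖ / rad (k i) (t i)) ^ I i := by
    intro I
    have e' : ∏ i, ‖t' i - t i‖ ^ I i =
        (∏ i, rad (k i) (t i) ^ I i) * ∏ i, (‖t' i - t i‖ / rad (k i) (t i)) ^ I i := by
      rw [← Finset.prod_mul_distrib]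
      refine Finset.prod_congr rfl fun i _ => ?_
      rw [← mul_pow, mul_div_cancel₀ _ (hr i).ne']
    rw [norm_mul, norm_prod]
    simp only [norm_pow]
    rw [e', ← mul_assoc]
    exact mul_le_mul_of_nonneg_right (norm_mvHasse_mul_prod_le P t k hK ht I)
      (Finset.prod_nonneg fun i _ => pow_nonneg (hρ0 i) _)
  by_cases h0 : MvPolynomial.aeval t P = 0
  · left
    rw [e, Finset.sum_eq_zero, add_zero]
    intro I _
    exact norm_le_zero_iff.1 ((hterm I).trans (by simp [h0]))
  · right
    have hpos : 0 < ‖MvPolynomial.aeval t P‖ := norm_pos_iff.2 h0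
    rw [norm_sub_rev, e, add_sub_cancel_left]
    refine Finset.sum_induction _ (fun x : Ω => ‖x‖ < α * ‖MvPolynomial.aeval t P‖)
      (fun x y hx hy => (IsUltrametricDist.norm_add_le_max x y).trans_lt (max_lt hx hy)) (by simp; positivity) ?_
    intro I hI
    refine (hterm I).trans_lt ?_
    rw [mul_comm α]
    exact mul_lt_mul_of_pos_left (hprod I hI) hpos

end MultivariateTaylor

lemma isNear_aeval_of_radS {K : Subfield Ω} {α : ℝ} (hα0 : 0 < α) (hα1 : α < 1) {S : Set Ω}
    {φ : Ω → Ω} (hφ : ∀ s ∈ S, dist s (φ s) < α * radS K S s) (P : MvPolynomial S K) :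
    IsNear α (MvPolynomial.aeval (fun s : S => (s : Ω)) P)
      (MvPolynomial.aeval (fun s : S => φ s) P) := by
  obtain ⟨n, f, hf, q, rfl⟩ := MvPolynomial.exists_fin_rename P
  rw [MvPolynomial.aeval_rename, MvPolynomial.aeval_rename]
  refine isNear_aeval hα0 hα1 q _ _ (fun i => hatGen K (S \ {(f i : Ω)}))
    (fun i c hc => mem_hatGen_of_mem hc) (fun i l hl => mem_hatGen_of_mem_set ⟨(f l).2, ?_⟩)
    fun i => hφ _ (f i).2
  simpa [Subtype.coe_inj] using hf.ne hl

open scoped IntermediateField.algebraAdjoinAdjoin in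
lemma exists_adjoin_hom_isNear {K : Subfield Ω} {α : ℝ} (hα0 : 0 < α) (hα1 : α < 1) {S : Set Ω}
    {φ : Ω → Ω} (hφ : ∀ s ∈ S, dist s (φ s) < α * radS K S s) :
    ∃ ψ : IntermediateField.adjoin K S →ₐ[K] Ω,
      (∀ x : IntermediateField.adjoin K S, IsNear α (x : Ω) (ψ x)) ∧
      ∀ (s : Ω) (hs : s ∈ S), ψ ⟨s, IntermediateField.subset_adjoin K S hs⟩ = φ s := by
  have hmem : ∀ P : MvPolynomial S K,
      MvPolynomial.aeval (fun s : S => (s : Ω)) P ∈ Algebra.adjoin K S := fun P => by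
    rw [Algebra.adjoin_eq_range]
    exact ⟨P, rfl⟩
  set f : MvPolynomial S K →ₐ[K] Algebra.adjoin K S :=
    (MvPolynomial.aeval (fun s : S => (s : Ω))).codRestrict _ hmem
  set g : MvPolynomial S K →ₐ[K] Ω := MvPolynomial.aeval (fun s : S => φ s)
  have hnear : ∀ P, IsNear α (f P : Ω) (g P) := isNear_aeval_of_radS hα0 hα1 hφ
  have hf : Function.Surjective f := by
    rintro ⟨x, hx⟩
    rw [Algebra.adjoin_eq_range] at hx
    obtain ⟨P, rfl⟩ := hx
    exact ⟨P, rfl⟩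
  have hker : ∀ P, f P = 0 → g P = 0 := fun P hP => by
    have := (hnear P).norm_eq hα1
    simpa [hP] using this
  set ψ₀ := AlgHom.liftOfSurjective f hf g hker
  have hψ₀ : ∀ P, ψ₀ (f P) = g P := AlgHom.liftOfSurjective_apply f hf g hker
  have hnear₀ : ∀ a : Algebra.adjoin K S, IsNear α (a : Ω) (ψ₀ a) := fun a => by
    obtain ⟨P, rfl⟩ := hf a
    rw [hψ₀]
    exact hnear P
  have hinj : Function.Injective ψ₀ := by
    refine (injective_iff_map_eq_zero ψ₀).2 fun a ha => ?_
    have := (hnear₀ a).norm_eq hα1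
    simpa [ha, eq_comm] using this
  set ψ : IntermediateField.adjoin K S →ₐ[K] Ω := IsFractionRing.liftAlgHom hinj
  have hψ : ∀ a, ψ (algebraMap (Algebra.adjoin K S) (IntermediateField.adjoin K S) a) = ψ₀ a :=
    IsFractionRing.lift_algebraMap (g := (ψ₀ : Algebra.adjoin K S →+* Ω)) hinj
  refine ⟨ψ, fun x => ?_, fun s hs => ?_⟩
  · obtain ⟨a, b, -, rfl⟩ := IsFractionRing.div_surjective (A := Algebra.adjoin K S) x
    rw [map_div₀, hψ, hψ]
    exact (hnear₀ a).div (hnear₀ b) hα0 hα1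
  · refine (hψ ⟨s, Algebra.subset_adjoin hs⟩).trans ?_
    have : (⟨s, Algebra.subset_adjoin hs⟩ : Algebra.adjoin K S) = f (MvPolynomial.X ⟨s, hs⟩) :=
      Subtype.ext (MvPolynomial.aeval_X (fun s : S => (s : Ω)) ⟨s, hs⟩).symm
    rw [this, hψ₀]
    exact MvPolynomial.aeval_X _ _

lemma adjoin_toSubfield (K : Subfield Ω) (S : Set Ω) :
    (IntermediateField.adjoin K S).toSubfield = Subfield.closure ((K : Set Ω) ∪ S) := by
  have : Set.range (algebraMap K Ω) = K := Subtype.range_coe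
  rw [← this]
  rfl

lemma isClosed_hatGen (K : Subfield Ω) (S : Set Ω) : IsClosed (hatGen K S : Set Ω) :=
  Subfield.isClosed_topologicalClosure _

lemma hatGen_le {K E : Subfield Ω} {S : Set Ω} (hE : IsClosed (E : Set Ω)) (hK : K ≤ E)
    (hS : S ⊆ E) : hatGen K S ≤ E :=
  Subfield.topologicalClosure_minimal _ (Subfield.closure_le.2 (Set.union_subset hK hS)) hE

lemma subfield_hatGen_eq_top {K : Subfield Ω} {S : Set Ω} {E : Subfield (hatGen K S)}
    (hE : IsClosed (E : Set (hatGen K S)))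
    (hK : ∀ (c : Ω) (hc : c ∈ K), (⟨c, mem_hatGen_of_mem hc⟩ : hatGen K S) ∈ E)
    (hS : ∀ (s : Ω) (hs : s ∈ S), (⟨s, mem_hatGen_of_mem_set hs⟩ : hatGen K S) ∈ E) : E = ⊤ := by
  have hle : hatGen K S ≤ E.map (hatGen K S).subtype := by
    refine hatGen_le ?_ (fun c hc => ⟨_, hK c hc, rfl⟩) fun s hs => ⟨_, hS s hs, rfl⟩
    exact (isClosed_hatGen K S).isClosedEmbedding_subtypeVal.isClosedMap _ hE
  refine eq_top_iff.2 fun x _ => ?_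
  obtain ⟨y, hy, hyx⟩ := hle x.2
  rwa [← Subtype.ext hyx]

lemma exists_hatGen_hom_isNear {K : Subfield Ω} {α : ℝ} (hα0 : 0 < α) (hα1 : α < 1) {S : Set Ω}
    {φ : Ω → Ω} (hφ : ∀ s ∈ S, dist s (φ s) < α * radS K S s) :
    ∃ ψ : hatGen K S →+* Ω, (∀ x : hatGen K S, IsNear α (x : Ω) (ψ x)) ∧
      (∀ (c : Ω) (hc : c ∈ K), ψ ⟨c, mem_hatGen_of_mem hc⟩ = c) ∧
      ∀ (s : Ω) (hs : s ∈ S), ψ ⟨s, mem_hatGen_of_mem_set hs⟩ = φ s := by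
  obtain ⟨ψ₀, hnear, hS⟩ := exists_adjoin_hom_isNear hα0 hα1 hφ
  have hle : (IntermediateField.adjoin K S).toSubfield ≤ hatGen K S := by
    rw [adjoin_toSubfield]
    exact Subfield.le_topologicalClosure _
  set i : IntermediateField.adjoin K S →+* hatGen K S := Subfield.inclusion hle
  have hi : IsUniformInducing i :=
    (AddMonoidHomClass.isometry_of_norm i fun _ => rfl).isUniformInducing
  have hd : DenseRange i := by
    refine Subtype.dense_iff.2 fun x hx => ?_
    refine closure_mono ?_ (show x ∈ closure (Subfield.closure ((K : Set Ω) ∪ S) : Set Ω) from hx)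
    rw [← adjoin_toSubfield]
    exact fun y hy => ⟨_, ⟨⟨y, hy⟩, rfl⟩, rfl⟩
  have hu : UniformContinuous (ψ₀ : IntermediateField.adjoin K S →+* Ω) :=
    (AddMonoidHomClass.isometry_of_norm (ψ₀ : IntermediateField.adjoin K S →+* Ω)
      fun x => (hnear x).norm_eq hα1).uniformContinuous
  set ψ : hatGen K S →+* Ω := IsDenseInducing.extendRingHom hi hd hu
  have hψc : Continuous ψ := (uniformContinuous_uniformly_extend hi hd hu).continuous
  have hψ : ∀ x, ψ (i x) = ψ₀ x := (hi.isDenseInducing hd).extend_eq hu.continuous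
  have hnorm : ∀ x, ‖ψ x‖ = ‖x‖ := fun x =>
    isClosed_property hd (isClosed_eq hψc.norm continuous_norm)
      (fun z => by rw [hψ]; exact (hnear z).norm_eq hα1) x
  refine ⟨ψ, fun x => ?_, fun c hc => ?_, fun s hs => (hψ _).trans (hS s hs)⟩
  · by_cases hx : x = 0
    · left; simp [hx]
    have hpos : 0 < ‖x‖ := norm_pos_iff.2 hx
    obtain ⟨z, hz⟩ := hd.exists_dist_lt x (mul_pos hα0 hpos)
    rw [dist_eq_norm] at hz
    have hz' : ‖(z : Ω)‖ ≤ ‖x‖ := by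
      have h := IsUltrametricDist.norm_add_le_max (x : Ω) (-(x - z))
      rw [norm_neg, neg_sub, add_sub_cancel] at h
      exact h.trans (max_le le_rfl (hz.le.trans (mul_le_of_le_one_left hpos.le hα1.le)))
    by_cases hz0 : (z : Ω) = 0
    · have hzx : ‖x‖ < α * ‖x‖ := by
        have : i z = 0 := Subtype.ext hz0
        rwa [this, sub_zero] at hz
      exact absurd hzx (mul_le_of_le_one_left hpos.le hα1.le).not_gt
    right
    have e : (x : Ω) - ψ x = ((z : Ω) - ψ₀ z) + (((x - i z : hatGen K S) : Ω) - ψ (x - i z)) := by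
      rw [map_sub, hψ]
      change (x : Ω) - ψ x = ((z : Ω) - ψ₀ z) + (((x : Ω) - (z : Ω)) - (ψ x - ψ₀ z))
      ring
    rw [e]
    refine (IsUltrametricDist.norm_add_le_max _ _).trans_lt (max_lt ?_ ?_)
    · exact ((hnear z).norm_sub_lt hα0 hz0).trans_le (mul_le_mul_of_nonneg_left hz' hα0.le)
    · rw [sub_eq_add_neg]
      refine (IsUltrametricDist.norm_add_le_max _ _).trans_lt (max_lt hz ?_)
      rw [norm_neg, hnorm]
      exact hz
  · exact (hψ (algebraMap K _ ⟨c, hc⟩)).trans (ψ₀.commutes _)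

/-- Theorem 3.1.5: an `α`-perturbation `φ : S → L` (with image `S' = φ '' S`)
extends uniquely to an isometric `K`-isomorphism `hat{K(S)} ≅ hat{K(S')}`, and this extension
is an `α`-perturbation of the identity of `hat{K(S)}`. -/
theorem set_perturbation (K L : Subfield Ω)
    (hKc : IsClosed (K : Set Ω)) (hLc : IsClosed (L : Set Ω)) (hKL : K ≤ L)
    (α : ℝ) (hα0 : 0 < α) (hα1 : α < 1)
    (S : Set Ω) (hS : S ⊆ (L : Set Ω))
    (φ : Ω → Ω) (hφL : ∀ s ∈ S, φ s ∈ L)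
    (hφ : ∀ s ∈ S, dist s (φ s) < α * radS K S s) :
    ∃ Φ : (hatGen K S) ≃+* (hatGen K (φ '' S)),
      (∀ x : hatGen K S, ‖(Φ x : Ω)‖ = ‖(x : Ω)‖) ∧
      (∀ (c : Ω) (hc : c ∈ K), (Φ ⟨c, mem_hatGen_of_mem hc⟩ : Ω) = c) ∧
      (∀ (s : Ω) (hs : s ∈ S), (Φ ⟨s, mem_hatGen_of_mem_set hs⟩ : Ω) = φ s) ∧
      (∀ x : hatGen K S, x ≠ 0 → ‖(x : Ω) - (Φ x : Ω)‖ < α * ‖(x : Ω)‖) ∧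
      (∀ Ψ : (hatGen K S) ≃+* (hatGen K (φ '' S)),
        (∀ x : hatGen K S, ‖(Ψ x : Ω)‖ = ‖(x : Ω)‖) →
        (∀ (c : Ω) (hc : c ∈ K), (Ψ ⟨c, mem_hatGen_of_mem hc⟩ : Ω) = c) →
        (∀ (s : Ω) (hs : s ∈ S), (Ψ ⟨s, mem_hatGen_of_mem_set hs⟩ : Ω) = φ s) → Ψ = Φ) := by
  obtain ⟨ψ, hnear, hK, hSφ⟩ := exists_hatGen_hom_isNear hα0 hα1 hφ
  have hnorm : ∀ x, ‖ψ x‖ = ‖x‖ := fun x => (hnear x).norm_eq hα1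
  have hiso : Isometry ψ := AddMonoidHomClass.isometry_of_norm ψ hnorm
  have hcomplete : CompleteSpace (hatGen K S) := (isClosed_hatGen K S).completeSpace_coe
  have hmem : ∀ x, ψ x ∈ hatGen K (φ '' S) := by
    have htop : (hatGen K (φ '' S)).comap ψ = ⊤ := by
      refine subfield_hatGen_eq_top ((isClosed_hatGen K (φ '' S)).preimage hiso.continuous)
        (fun c hc => ?_) fun s hs => ?_
      · rw [Subfield.mem_comap, hK c hc]
        exact mem_hatGen_of_mem hc
      · rw [Subfield.mem_comap, hSφ s hs]
        exact mem_hatGen_of_mem_set ⟨s, hs, rfl⟩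
    exact fun x => Subfield.mem_comap.1 (htop ▸ Subfield.mem_top x)
  have hle : hatGen K (φ '' S) ≤ ψ.fieldRange := by
    refine hatGen_le ?_ (fun c hc => ⟨_, hK c hc⟩) ?_
    · rw [RingHom.coe_fieldRange]
      exact hiso.isClosedEmbedding.isClosed_range
    · rintro _ ⟨s, hs, rfl⟩
      exact ⟨_, hSφ s hs⟩
  have hbij : Function.Bijective (ψ.codRestrict (hatGen K (φ '' S)) hmem) := by
    refine ⟨RingHom.injective _, fun y => ?_⟩
    obtain ⟨x, hx⟩ := hle y.2
    exact ⟨x, Subtype.ext hx⟩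
  refine ⟨RingEquiv.ofBijective _ hbij, hnorm, hK, hSφ,
    fun x hx => (hnear x).norm_sub_lt hα0 (by simpa using hx), fun Ψ hΨ hΨK hΨS => ?_⟩
  set χ : hatGen K S →+* Ω := (hatGen K (φ '' S)).subtype.comp (Ψ : hatGen K S →+* _)
  have hχ : Isometry χ := AddMonoidHomClass.isometry_of_norm χ hΨ
  have htop : χ.eqLocusField ψ = ⊤ :=
    subfield_hatGen_eq_top (isClosed_eq hχ.continuous hiso.continuous)
      (fun c hc => (hΨK c hc).trans (hK c hc).symm) fun s hs => (hΨS s hs).trans (hSφ s hs).symm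
  refine RingEquiv.ext fun x => Subtype.ext ?_
  exact RingHom.mem_eqLocusField.1 (htop ▸ Subfield.mem_top x : x ∈ χ.eqLocusField ψ)
end

section
/- If L/K is an extension of analytic fields with Topdeg(L/K) finite, then topdeg(L/K) = Topdeg(L/K), L/K possesses a topological transcendence basis, and every topological transcendence basis of L/K has cardinality topdeg(L/K). -/
open Metric

set_option linter.unusedSectionVars false

/-!
Ambient setting: every extension of analytic (complete, non-archimedean, real-valued)
fields `L/K` embeds isometrically into an algebraically closed, complete,
non-archimedean normed field `Ω` (e.g. the completed algebraic closure of `L`).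
We therefore formalize analytic fields as closed subfields of such an ambient field `Ω`.
-/

variable {Ω : Type*} [NormedField Ω] [CompleteSpace Ω] [IsUltrametricDist Ω] [IsAlgClosed Ω]

open Polynomial in
theorem isAlgebraic_of_subset {σ τ : Type*} [SetLike σ Ω] [SubringClass σ Ω] [SetLike τ Ω]
    [SubringClass τ Ω] {A : σ} {B : τ} (h : ∀ x ∈ A, x ∈ B) {x : Ω} (hx : IsAlgebraic A x) :
    IsAlgebraic B x := by
  obtain ⟨p, hp, hpx⟩ := hx
  let f : A →+* B := (SubringClass.subtype A).codRestrict B fun y => h y y.2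
  have hf : Function.Injective f := fun a b hab => Subtype.ext (congrArg (fun z : B => (z : Ω)) hab)
  refine ⟨p.map f, (Polynomial.map_ne_zero_iff hf).2 hp, ?_⟩
  rw [aeval_def, eval₂_map]
  exact hpx

theorem hatGen_mono {K : Subfield Ω} {S T : Set Ω} (h : S ⊆ T) : hatGen K S ≤ hatGen K T :=
  closure_mono (Subfield.closure_mono (Set.union_subset_union_right _ h))

theorem TopgebraicIndep.mono {K : Subfield Ω} {S T : Set Ω} (hT : TopgebraicIndep K T)
    (h : S ⊆ T) : TopgebraicIndep K S := fun x hx hx' =>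
  hT x (h hx) (closure_mono (fun _ hy => isAlgebraic_of_subset
    (hatGen_mono (Set.sdiff_subset_sdiff_left h)) hy) hx')

theorem pow_card_le_norm_multiset_prod {ε : ℝ} (hε : 0 ≤ ε) {s : Multiset Ω}
    (hs : ∀ z ∈ s, ε ≤ ‖z‖) : ε ^ s.card ≤ ‖s.prod‖ := by
  induction s using Multiset.induction_on with
  | empty => simp
  | cons z s ih =>
    rw [Multiset.card_cons, Multiset.prod_cons, norm_mul, pow_succ']
    exact mul_le_mul (hs z (Multiset.mem_cons_self z s))
      (ih fun y hy => hs y (Multiset.mem_cons_of_mem hy)) (by positivity) (norm_nonneg _)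

open Polynomial in
/-- By continuity of roots, the elements algebraic over `F` are dense in those algebraic over the
closure of `F`. -/
theorem mem_closure_isAlgebraic_of_topologicalClosure {F : Subfield Ω} {a : Ω}
    (ha : IsAlgebraic F.topologicalClosure a) : a ∈ closure {x : Ω | IsAlgebraic F x} := by
  rw [Metric.mem_closure_iff]
  intro ε hε
  have hint : IsIntegral F.topologicalClosure a := ha.isIntegral
  obtain ⟨p, hp, hpa⟩ := hint
  set n := p.natDegree with hn
  have hM : 0 < max 1 ‖a‖ ^ n := by positivity
  have hδ : 0 < ε ^ n / max 1 ‖a‖ ^ n := by positivity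
  have hb : ∀ i, ∃ b : F, ‖(b : Ω) - p.coeff i‖ < ε ^ n / max 1 ‖a‖ ^ n := fun i => by
    obtain ⟨b, hb, hd⟩ := Metric.mem_closure_iff.1 (p.coeff i).2 _ hδ
    exact ⟨⟨b, hb⟩, by rwa [dist_comm, dist_eq_norm] at hd⟩
  choose b hb using hb
  let q : F[X] := X ^ n + ∑ i ∈ Finset.range n, C (b i) * X ^ i
  have hdeg : (∑ i ∈ Finset.range n, C (b i) * X ^ i).degree < (n : WithBot ℕ) := by
    refine (degree_sum_le _ _).trans_lt ((Finset.sup_lt_iff (WithBot.bot_lt_coe n)).2 fun i hi => ?_)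
    exact (degree_C_mul_X_pow_le _ _).trans_lt (WithBot.coe_lt_coe.2 (Finset.mem_range.1 hi))
  have hqm : q.Monic := monic_X_pow_add hdeg
  have hqn : q.natDegree = n := by
    apply natDegree_eq_of_degree_eq_some
    rw [degree_add_eq_left_of_degree_lt] <;> simp [hdeg]
  have hpe : a ^ n + ∑ i ∈ Finset.range n, (p.coeff i : Ω) * a ^ i = 0 := by
    have h := hpa
    rw [hp.as_sum, eval₂_add, eval₂_finsetSum] at h
    simp only [eval₂_mul, eval₂_pow, eval₂_X, eval₂_C] at h
    exact h
  have hqe : aeval a q = ∑ i ∈ Finset.range n, ((b i : Ω) - p.coeff i) * a ^ i := by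
    have : aeval a q = a ^ n + ∑ i ∈ Finset.range n, (b i : Ω) * a ^ i := by
      simp only [q, map_add, map_sum, map_mul, map_pow, aeval_X, aeval_C]
      rfl
    rw [this, ← sub_zero (a ^ n + _), ← hpe]
    simp only [sub_mul, Finset.sum_sub_distrib]
    ring
  have hlt : ‖aeval a q‖ < ε ^ n := by
    rw [hqe]
    rcases (Finset.range n).eq_empty_or_nonempty with h0 | h0
    · simpa [h0] using pow_pos hε n
    obtain ⟨i, hi, hle⟩ := IsUltrametricDist.exists_norm_finsetSum_le_of_nonempty h0
      (fun i => ((b i : Ω) - p.coeff i) * a ^ i)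
    refine hle.trans_lt ?_
    rw [norm_mul, norm_pow]
    calc ‖(b i : Ω) - p.coeff i‖ * ‖a‖ ^ i ≤ ‖(b i : Ω) - p.coeff i‖ * max 1 ‖a‖ ^ n := by
          gcongr
          calc ‖a‖ ^ i ≤ max 1 ‖a‖ ^ i := by gcongr; exact le_max_right _ _
            _ ≤ max 1 ‖a‖ ^ n := pow_le_pow_right₀ (le_max_left _ _) (Finset.mem_range.1 (hi)).le
      _ < ε ^ n / max 1 ‖a‖ ^ n * max 1 ‖a‖ ^ n := by gcongr; exact hb i
      _ = ε ^ n := div_mul_cancel₀ _ hM.ne'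
  by_contra! hfar
  rw [(IsAlgClosed.splits _).aeval_eq_prod_aroots_of_monic hqm] at hlt
  refine hlt.not_ge ?_
  have hcard : (q.aroots Ω).card = n := by
    rw [aroots_def, ← (IsAlgClosed.splits _).natDegree_eq_card_roots, natDegree_map, hqn]
  rw [← hcard, ← Multiset.card_map (a - ·)]
  refine pow_card_le_norm_multiset_prod hε.le fun y hy => ?_
  obtain ⟨z, hz, rfl⟩ := Multiset.mem_map.1 hy
  rw [← dist_eq_norm]
  exact hfar z ⟨q, hqm.ne_zero, (mem_aroots.1 hz).2⟩

open Polynomial in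
/-- If no root of `g` has norm less than `r`, then the Gauss norm of radius `r` of `g` is attained
by its constant coefficient. -/
theorem norm_coeff_mul_pow_le_of_roots {g : Polynomial Ω} {r : ℝ} (hr : 0 ≤ r)
    (hg : ∀ z ∈ g.roots, r ≤ ‖z‖) (i : ℕ) : ‖g.coeff i‖ * r ^ i ≤ ‖g.coeff 0‖ := by
  rw [(IsAlgClosed.splits g).eq_prod_roots]
  simp only [coeff_C_mul, norm_mul, mul_assoc]
  refine mul_le_mul_of_nonneg_left ?_ (norm_nonneg _)
  generalize g.roots = s at hg
  induction s using Multiset.induction_on generalizing i with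
  | empty => cases i <;> simp [coeff_one]
  | cons z s ih =>
    replace ih := fun i => ih i fun y hy => hg y (Multiset.mem_cons_of_mem hy)
    have hz := hg z (Multiset.mem_cons_self z s)
    simp only [Multiset.map_cons, Multiset.prod_cons]
    set q := (s.map (X - C ·)).prod
    have h0 : ‖((X - C z) * q).coeff 0‖ = ‖z‖ * ‖q.coeff 0‖ := by simp [mul_coeff_zero]
    rw [h0]
    cases i with
    | zero => simp
    | succ i =>
      rw [sub_mul, coeff_sub, coeff_X_mul, coeff_C_mul, sub_eq_add_neg]
      have hmax := IsUltrametricDist.norm_add_le_max (q.coeff i) (-(z * q.coeff (i + 1)))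
      rw [norm_neg, norm_mul] at hmax
      refine (mul_le_mul_of_nonneg_right hmax (by positivity)).trans ?_
      rw [max_mul_of_nonneg _ _ (by positivity)]
      refine max_le ?_ ?_
      · calc ‖q.coeff i‖ * r ^ (i + 1) = r * (‖q.coeff i‖ * r ^ i) := by ring
          _ ≤ ‖z‖ * ‖q.coeff 0‖ := mul_le_mul hz (ih i) (by positivity) (norm_nonneg _)
      · rw [mul_assoc]
        exact mul_le_mul_of_nonneg_left (ih _) (norm_nonneg _)

section Taylor

variable {ι : Type*} [DecidableEq ι] {K : Subfield Ω}

/-- The Taylor expansion of a multivariate polynomial in its `j`-th variable: the polynomial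
in `T` obtained by substituting `X j + T` for `X j`. -/
noncomputable def taylorAt (K : Subfield Ω) (j : ι) :
    MvPolynomial ι K →ₐ[K] Polynomial (MvPolynomial ι K) :=
  MvPolynomial.aeval (Function.update (fun k => Polynomial.C (MvPolynomial.X k)) j
    (Polynomial.C (MvPolynomial.X j) + Polynomial.X))

theorem eval_map_taylorAt (j : ι) (p : ι → Ω) (t : Ω) (f : MvPolynomial ι K) :
    ((taylorAt K j f).map (MvPolynomial.aeval p : MvPolynomial ι K →ₐ[K] Ω).toRingHom).eval t =
      MvPolynomial.aeval (Function.update p j (p j + t)) f := by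
  induction f using MvPolynomial.induction_on with
  | C a => simp [taylorAt]
  | add f g hf hg => rw [map_add, Polynomial.map_add, Polynomial.eval_add, hf, hg, map_add]
  | mul_X f k hf =>
    rw [map_mul, Polynomial.map_mul, Polynomial.eval_mul, hf, map_mul]
    congr 1
    by_cases h : k = j
    · subst h; simp [taylorAt]
    · simp [taylorAt, h]

theorem aeval_coeff_zero_taylorAt (j : ι) (p : ι → Ω) (f : MvPolynomial ι K) :
    MvPolynomial.aeval p ((taylorAt K j f).coeff 0) = MvPolynomial.aeval p f := by
  have h := eval_map_taylorAt j p 0 f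
  rw [← Polynomial.coeff_zero_eq_eval_zero, Polynomial.coeff_map, add_zero,
    Function.update_eq_self] at h
  exact h

theorem aeval_update_eq_sum (j : ι) (p : ι → Ω) (t : Ω) (f : MvPolynomial ι K) :
    MvPolynomial.aeval (Function.update p j (p j + t)) f =
      ∑ i ∈ Finset.range (taylorAt K j f).natDegree,
        MvPolynomial.aeval p ((taylorAt K j f).coeff (i + 1)) * t ^ (i + 1) +
      MvPolynomial.aeval p f := by
  rw [← eval_map_taylorAt, Polynomial.eval_map, Polynomial.eval₂_eq_sum_range,
    Finset.sum_range_succ', pow_zero, mul_one]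
  congr 1
  exact aeval_coeff_zero_taylorAt j p f

theorem isAlgebraic_of_aeval_update_eq_zero {M : Subfield Ω} (hKM : K ≤ M) {s : ι → Ω} {j : ι}
    (hs : ∀ k ≠ j, s k ∈ M) {f : MvPolynomial ι K} {x y : Ω}
    (hx : MvPolynomial.aeval (Function.update s j x) f ≠ 0)
    (hy : MvPolynomial.aeval (Function.update s j y) f = 0) : IsAlgebraic M y := by
  have hc : ∀ k, ∃ c : M, k ≠ j → (c : Ω) = s k := fun k => by
    by_cases h : k = j
    · exact ⟨0, fun h' => (h' h).elim⟩
    · exact ⟨⟨s k, hs k h⟩, fun _ => rfl⟩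
  choose c hc using hc
  let φ : MvPolynomial ι K →+* Polynomial M :=
    MvPolynomial.eval₂Hom (Polynomial.C.comp (Subfield.inclusion hKM))
      (Function.update (fun k => Polynomial.C (c k)) j Polynomial.X)
  have key : ∀ z f, Polynomial.aeval z (φ f) = MvPolynomial.aeval (Function.update s j z) f := by
    intro z f
    induction f using MvPolynomial.induction_on with
    | C a => simp [φ]; rfl
    | add f g hf hg => rw [map_add, map_add, hf, hg, map_add]
    | mul_X f k hf =>
      rw [map_mul, map_mul, hf, map_mul]
      congr 1
      by_cases h : k = j
      · subst h; simp [φ]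
      · simpa [φ, h] using (show algebraMap M Ω (c k) = s k from hc k h)
  refine ⟨φ f, fun h0 => hx ?_, (key y f).trans hy⟩
  rw [← key x, h0, map_zero]

theorem norm_aeval_coeff_taylorAt_mul_pow_le {M : Subfield Ω} (hKM : K ≤ M) {s : ι → Ω} {j : ι}
    (hs : ∀ k ≠ j, s k ∈ M) {r : ℝ} (hr : 0 ≤ r)
    (hM : ∀ z, IsAlgebraic M z → r ≤ dist (s j) z) (f : MvPolynomial ι K) (i : ℕ) :
    ‖MvPolynomial.aeval s ((taylorAt K j f).coeff i)‖ * r ^ i ≤ ‖MvPolynomial.aeval s f‖ := by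
  rw [← aeval_coeff_zero_taylorAt j s f]
  have h := norm_coeff_mul_pow_le_of_roots
    (g := (taylorAt K j f).map (MvPolynomial.aeval s : MvPolynomial ι K →ₐ[K] Ω).toRingHom)
    hr (fun z hz => ?_) i
  · rw [Polynomial.coeff_map, Polynomial.coeff_map] at h
    exact h
  obtain ⟨hg, hz⟩ := Polynomial.mem_roots'.1 hz
  obtain ⟨t, ht⟩ : ∃ t, Polynomial.eval t ((taylorAt K j f).map
      (MvPolynomial.aeval s : MvPolynomial ι K →ₐ[K] Ω).toRingHom) ≠ 0 := by
    by_contra! h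
    exact hg (Polynomial.funext fun t => by rw [h t, Polynomial.eval_zero])
  rw [eval_map_taylorAt] at ht
  rw [Polynomial.IsRoot.def, eval_map_taylorAt] at hz
  simpa [dist_eq_norm] using hM _ (isAlgebraic_of_aeval_update_eq_zero hKM hs ht hz)

/-- Moving each coordinate of `s` by less than the corresponding radius does not change the norm of
the value of any polynomial. -/
theorem norm_aeval_eq_of_dist_lt [Fintype ι] {s s' : ι → Ω} {r : ι → ℝ}
    (hr : ∀ j (f : MvPolynomial ι K) i,
      ‖MvPolynomial.aeval s ((taylorAt K j f).coeff i)‖ * r j ^ i ≤ ‖MvPolynomial.aeval s f‖)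
    (hs' : ∀ j, dist (s j) (s' j) < r j) (f : MvPolynomial ι K) :
    ‖MvPolynomial.aeval s' f‖ = ‖MvPolynomial.aeval s f‖ := by
  suffices H : ∀ (T : Finset ι) (f : MvPolynomial ι K),
      ‖MvPolynomial.aeval (T.piecewise s' s) f‖ = ‖MvPolynomial.aeval s f‖ by
    simpa using H Finset.univ f
  intro T
  induction T using Finset.induction_on with
  | empty => simp
  | insert j T hj ih =>
    intro f
    set p := T.piecewise s' s with hp
    have hpj : p j = s j := Finset.piecewise_eq_of_notMem _ _ _ hj
    rw [Finset.piecewise_insert, show s' j = p j + (s' j - s j) by rw [hpj]; ring,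
      aeval_update_eq_sum, ← hp, ← ih f]
    set u := s' j - s j
    have hu : ‖u‖ < r j := by simpa only [u, dist_eq_norm, norm_sub_rev] using hs' j
    have hterm : ∀ i, ‖MvPolynomial.aeval p ((taylorAt K j f).coeff (i + 1)) * u ^ (i + 1)‖ ≤
        ‖MvPolynomial.aeval p f‖ * (‖u‖ / r j) ^ (i + 1) := fun i => by
      have hrj : 0 < r j := (norm_nonneg u).trans_lt hu
      rw [norm_mul, norm_pow, ih, ih, div_pow, ← mul_div_assoc, le_div_iff₀ (by positivity),
        mul_right_comm]
      exact mul_le_mul_of_nonneg_right (hr j f (i + 1)) (by positivity)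
    have hq0 : 0 ≤ ‖u‖ / r j := div_nonneg (norm_nonneg _) ((norm_nonneg _).trans hu.le)
    have hq : ‖u‖ / r j < 1 := (div_lt_one ((norm_nonneg _).trans_lt hu)).2 hu
    have hsum : ‖∑ i ∈ Finset.range (taylorAt K j f).natDegree,
        MvPolynomial.aeval p ((taylorAt K j f).coeff (i + 1)) * u ^ (i + 1)‖ ≤
        ‖MvPolynomial.aeval p f‖ * (‖u‖ / r j) := by
      refine IsUltrametricDist.norm_sum_le_of_forall_le_of_nonneg (by positivity) fun i _ =>
        (hterm i).trans (mul_le_mul_of_nonneg_left ?_ (norm_nonneg _))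
      exact pow_le_of_le_one hq0 hq.le i.succ_ne_zero
    rcases (norm_nonneg (MvPolynomial.aeval p f)).eq_or_lt with h0 | h0
    · rw [← h0, zero_mul, norm_le_zero_iff] at hsum
      rw [hsum, zero_add]
    · have hlt := hsum.trans_lt (mul_lt_of_lt_one_right h0 hq)
      rw [IsUltrametricDist.norm_add_eq_max_of_norm_ne_norm hlt.ne, max_eq_right hlt.le]

end Taylor

theorem closure_isAlgebraic_hatGen (K : Subfield Ω) (S : Set Ω) :
    closure {x : Ω | IsAlgebraic (hatGen K S) x} =
      closure {x : Ω | IsAlgebraic (Subfield.closure ((K : Set Ω) ∪ S)) x} := by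
  refine (closure_minimal (fun x hx => ?_) isClosed_closure).antisymm
    (closure_mono fun x hx => isAlgebraic_of_subset (Subfield.le_topologicalClosure _) hx)
  exact mem_closure_isAlgebraic_of_topologicalClosure hx

theorem TopgebraicIndep.algebraicIndependent {K : Subfield Ω} {S : Set Ω}
    (hS : TopgebraicIndep K S) : AlgebraicIndependent K ((↑) : S → Ω) := by
  refine algebraicIndependent_of_finite' S (algebraMap K Ω).injective
    fun t hts _ _ a ha hat halg => ?_
  refine hS a ha (subset_closure (isAlgebraic_of_subset (fun x hx => ?_) halg))
  induction hx using Algebra.adjoin_induction with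
  | mem x hx => exact mem_hatGen_of_mem_set ⟨hts hx, fun h => hat (h ▸ hx)⟩
  | algebraMap x => exact mem_hatGen_of_mem x.2
  | add x y _ _ hx hy => exact add_mem hx hy
  | mul x y _ _ hx hy => exact mul_mem hx hy

theorem isAlgebraic_adjoin_of_isAlgebraic_closure {K : Subfield Ω} {X : Set Ω} {x : Ω}
    (hx : IsAlgebraic (Subfield.closure ((K : Set Ω) ∪ X)) x) :
    IsAlgebraic (Algebra.adjoin K X) x := by
  rw [← IntermediateField.isAlgebraic_adjoin_iff]
  refine isAlgebraic_of_subset (fun y hy => ?_) hx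
  have : Set.range (algebraMap K Ω) = (K : Set Ω) := Subtype.range_coe
  rw [← this] at hy
  exact hy

theorem encard_le_of_generates_of_finite {K L : Subfield Ω} {S X : Set Ω} (hSL : S ⊆ L)
    (hS : TopgebraicIndep K S) (hX : TopgebraicallyGenerates K L X) (hfin : S.Finite) :
    S.encard ≤ X.encard := by
  classical
  have := hfin.fintype
  have hr : ∀ j : S, ∃ r > 0, ∀ z, IsAlgebraic (hatGen K (S \ {(j : Ω)})) z → r ≤ dist (j : Ω) z :=
    fun j => by
      have h : (j : Ω) ∉ closure _ := hS j j.2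
      rw [Metric.mem_closure_iff] at h
      push Not at h
      exact h
  choose r hr0 hr using hr
  have happ : ∀ j : S, ∃ z, IsAlgebraic (Subfield.closure ((K : Set Ω) ∪ X)) z ∧
      dist (j : Ω) z < r j := fun j => by
    have h := hX (hSL j.2)
    rw [closure_isAlgebraic_hatGen] at h
    exact Metric.mem_closure_iff.1 h _ (hr0 j)
  choose s' hs' hd using happ
  have hmem : ∀ j k : S, k ≠ j → (k : Ω) ∈ hatGen K (S \ {(j : Ω)}) := fun j k hk =>
    mem_hatGen_of_mem_set ⟨k.2, fun h => hk (Subtype.ext h)⟩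
  have hind : AlgebraicIndependent K s' := by
    rw [algebraicIndependent_iff]
    intro f hf
    have h := norm_aeval_eq_of_dist_lt (s := ((↑) : S → Ω)) (fun j f i =>
      norm_aeval_coeff_taylorAt_mul_pow_le (fun _ => mem_hatGen_of_mem)
        (hmem j) (hr0 j).le (hr j) f i) hd f
    rw [hf, norm_zero, eq_comm, norm_eq_zero] at h
    exact algebraicIndependent_iff.1 hS.algebraicIndependent f h
  have hM : (AlgebraicIndependent.matroid K Ω).Indep (Set.range s') := hind.to_subtype_range
  have hsub : Set.range s' ⊆ (AlgebraicIndependent.matroid K Ω).closure X := by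
    rw [AlgebraicIndependent.matroid_closure_eq]
    rintro _ ⟨j, rfl⟩
    exact isAlgebraic_adjoin_of_isAlgebraic_closure (hs' j)
  calc S.encard ≤ (Set.range s').encard := hind.injective.encard_range
    _ ≤ X.encard := (hM.encard_le_eRk_of_subset hsub).trans
      ((Matroid.eRk_closure_eq _ X).trans_le (Matroid.eRk_le_encard _ X))

theorem TopgebraicIndep.encard_le {K L : Subfield Ω} {S X : Set Ω} (hS : TopgebraicIndep K S)
    (hSL : S ⊆ L) (hX : TopgebraicallyGenerates K L X) : S.encard ≤ X.encard := by
  by_contra! hlt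
  obtain ⟨T, hTS, hT⟩ := Set.exists_subset_encard_eq (Order.add_one_le_of_lt hlt)
  have hXfin : X.encard ≠ ⊤ := hlt.ne_top
  have hTfin : T.Finite := by
    rw [← Set.encard_ne_top_iff, hT]
    simpa using hXfin
  have h := encard_le_of_generates_of_finite (hTS.trans hSL) (hS.mono hTS) hX hTfin
  rw [hT] at h
  exact h.not_gt (ENat.lt_add_one_iff hXfin |>.2 le_rfl)

theorem TopgebraicIndep.cardinalMk_le {K L : Subfield Ω} {S X : Set Ω} (hS : TopgebraicIndep K S)
    (hSL : S ⊆ L) (hX : TopgebraicallyGenerates K L X) (hfin : X.Finite) :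
    Cardinal.mk S ≤ Cardinal.mk X := by
  have h := hS.encard_le hSL hX
  obtain ⟨n, hn⟩ := Cardinal.lt_aleph0.1 (Cardinal.lt_aleph0_iff_set_finite.2 hfin)
  rw [hn, ← Cardinal.toENat_le_natCast, ← Cardinal.toENat_nat, ← hn]
  exact h

/-- A topgebraic element of a generating set is redundant. -/
theorem TopgebraicallyGenerates.sdiff_singleton {K L : Subfield Ω} {X : Set Ω}
    (hX : TopgebraicallyGenerates K L X) {x : Ω}
    (hx : IsTopgebraicElem (hatGen K (X \ {x})) x) :
    TopgebraicallyGenerates K L (X \ {x}) := by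
  set F := Subfield.closure ((K : Set Ω) ∪ X \ {x}) with hF
  let A : Subfield Ω := (algebraicClosure F Ω).toSubfield
  have hmem : ∀ y, y ∈ A ↔ IsAlgebraic F y := fun y => mem_algebraicClosure_iff
  have hA : closure (A : Set Ω) = closure {y : Ω | IsAlgebraic F y} :=
    congrArg closure (Set.ext hmem)
  have hFA : F ≤ A := fun y hy =>
    (hmem y).2 (isAlgebraic_algebraMap (⟨y, hy⟩ : F))
  have hle : hatGen K X ≤ A.topologicalClosure := by
    refine Subfield.topologicalClosure_minimal _ (Subfield.closure_le.2 ?_)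
      (Subfield.isClosed_topologicalClosure _)
    rintro y (hy | hy)
    · exact subset_closure (hFA (Subfield.subset_closure (Or.inl hy)))
    · by_cases hyx : y = x
      · subst hyx
        have h : y ∈ closure _ := hx
        rw [closure_isAlgebraic_hatGen, ← hF, ← hA] at h
        exact h
      · exact subset_closure (hFA (Subfield.subset_closure (Or.inr ⟨hy, hyx⟩)))
  have halg : ∀ y, IsAlgebraic A y → y ∈ A := fun y hy => by
    have := algebraicClosure.isAlgebraic F Ω
    exact (hmem y).2 <| IsAlgebraic.restrictScalars F (S := algebraicClosure F Ω) hy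
  intro y hy
  rw [closure_isAlgebraic_hatGen, ← hF, ← hA]
  refine closure_minimal (fun z hz => ?_) isClosed_closure (hX hy)
  refine closure_mono halg ?_
  exact mem_closure_isAlgebraic_of_topologicalClosure (isAlgebraic_of_subset hle hz)

theorem topgebraicallyGenerates_self (K L : Subfield Ω) : TopgebraicallyGenerates K L L :=
  fun x hx => subset_closure (isAlgebraic_algebraMap (⟨x, mem_hatGen_of_mem_set hx⟩ : hatGen K L))

theorem exists_generates_cardinalMk_eq_Topdeg (K L : Subfield Ω) :
    ∃ S : Set Ω, S ⊆ L ∧ TopgebraicallyGenerates K L S ∧ Cardinal.mk S = Topdeg K L := by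
  have : Nonempty {S : Set Ω // S ⊆ (L : Set Ω) ∧ TopgebraicallyGenerates K L S} :=
    ⟨⟨L, subset_rfl, topgebraicallyGenerates_self K L⟩⟩
  obtain ⟨⟨S, hSL, hS⟩, h⟩ := ciInf_mem
    fun S : {S : Set Ω // S ⊆ (L : Set Ω) ∧ TopgebraicallyGenerates K L S} => Cardinal.mk S.1
  exact ⟨S, hSL, hS, h⟩

theorem Topdeg_le_cardinalMk {K L : Subfield Ω} {S : Set Ω} (hSL : S ⊆ L)
    (hS : TopgebraicallyGenerates K L S) : Topdeg K L ≤ Cardinal.mk S :=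
  ciInf_le' (fun S : {S : Set Ω // S ⊆ (L : Set Ω) ∧ TopgebraicallyGenerates K L S} =>
    Cardinal.mk S.1) ⟨S, hSL, hS⟩

theorem TopgebraicallyGenerates.topgebraicIndep {K L : Subfield Ω} {X : Set Ω}
    (hX : TopgebraicallyGenerates K L X) (hXL : X ⊆ L) (hfin : X.Finite)
    (hmin : Cardinal.mk X = Topdeg K L) : TopgebraicIndep K X := by
  intro x hx halg
  have h := Topdeg_le_cardinalMk (Set.sdiff_subset.trans hXL) (hX.sdiff_singleton halg)
  rw [← hmin] at h
  exact (Cardinal.toNat_le_toNat h (Cardinal.lt_aleph0_iff_set_finite.2 (hfin.subset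
    Set.sdiff_subset))).not_gt (Set.ncard_sdiff_singleton_lt_of_mem hx hfin)

/-- Theorem 3.2.2: if `L/K` has finite topgebraic generating degree then
`topdeg(L/K) = Topdeg(L/K)`, `L/K` possesses a topological transcendence basis, and any
such basis has cardinality `topdeg(L/K)`. -/
theorem finite_Topdeg_basis (K L : Subfield Ω)
    (hKc : IsClosed (K : Set Ω)) (hLc : IsClosed (L : Set Ω)) (hKL : K ≤ L)
    (hfin : Topdeg K L < Cardinal.aleph0) :
    topdeg K L = Topdeg K L ∧
    (∃ S : Set Ω, S ⊆ (L : Set Ω) ∧ TopgebraicIndep K S ∧ TopgebraicallyGenerates K L S) ∧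
    (∀ S : Set Ω, S ⊆ (L : Set Ω) → TopgebraicIndep K S → TopgebraicallyGenerates K L S →
      Cardinal.mk S = topdeg K L) := by
  obtain ⟨X, hXL, hX, hXcard⟩ := exists_generates_cardinalMk_eq_Topdeg K L
  have hXfin : X.Finite := Cardinal.lt_aleph0_iff_set_finite.1 (hXcard ▸ hfin)
  have hXind := hX.topgebraicIndep hXL hXfin hXcard
  have hle : ∀ S : {S : Set Ω // S ⊆ (L : Set Ω) ∧ TopgebraicIndep K S},
      Cardinal.mk S.1 ≤ Cardinal.mk X := fun S => S.2.2.cardinalMk_le S.2.1 hX hXfin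
  have hdeg : topdeg K L = Topdeg K L := by
    rw [← hXcard]
    have : Nonempty {S : Set Ω // S ⊆ (L : Set Ω) ∧ TopgebraicIndep K S} := ⟨⟨X, hXL, hXind⟩⟩
    exact (ciSup_le hle).antisymm (le_ciSup (f := fun S : {S : Set Ω // S ⊆ (L : Set Ω) ∧
      TopgebraicIndep K S} => Cardinal.mk S.1) ⟨_, Set.forall_mem_range.2 hle⟩ ⟨X, hXL, hXind⟩)
  refine ⟨hdeg, ⟨X, hXL, hXind, hX⟩, fun S hSL hSind hS => ?_⟩
  rw [hdeg]
  exact (hXcard ▸ hle ⟨S, hSL, hSind⟩).antisymm (Topdeg_le_cardinalMk hSL hS)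
end
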